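/- Let G be a finite simple graph on a vertex set V whose edge set E is partitioned into pairwise disjoint sets E₁, …, E_c, and let G_i := (V, E_i). Let k ≥ 1 and, for each i, let H_i be a k-connectivity certificate of G_i. Then H := H₁ ∪ … ∪ H_c is a k-connectivity certificate of G, i.e. for every S ⊆ V, min(k, |∂_H(S)|) = min(k, |∂_G(S)|). -/

import Mathlib

open scoped Classical

/-- The edge boundary of a vertex set `S` in a simple graph `G`: the set of edges of `G`
with exactly one endpoint in `S`. -/
noncomputable def edgeBoundary {V : Type*} [Fintype V] (G : SimpleGraph V) (S : Finset V) :
    Finset (Sym2 V) :=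
  Finset.univ.filter (fun e => e ∈ G.edgeSet ∧ ∃ v w, e = s(v, w) ∧ v ∈ S ∧ w ∉ S)

/-- `H` is a `k`-connectivity certificate of `G`: a subgraph of `G` preserving all cuts
of size at most `k`. -/
def IsConnCertificate {V : Type*} [Fintype V] (k : ℕ) (G H : SimpleGraph V) : Prop :=
  H ≤ G ∧ ∀ S : Finset V, min k (edgeBoundary H S).card = min k (edgeBoundary G S).card

theorem mem_edgeBoundary_iSup {V ι : Type*} [Fintype V] (G : ι → SimpleGraph V) (S : Finset V)
    (e : Sym2 V) : e ∈ edgeBoundary (⨆ i, G i) S ↔ ∃ i, e ∈ edgeBoundary (G i) S := by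
  induction e using Sym2.ind with
  | _ x y =>
    simp only [edgeBoundary, Finset.mem_filter, Finset.mem_univ, true_and,
      SimpleGraph.mem_edgeSet, SimpleGraph.iSup_adj, exists_and_right]

theorem edgeBoundary_mono {V : Type*} [Fintype V] {G H : SimpleGraph V} (h : H ≤ G)
    (S : Finset V) : edgeBoundary H S ⊆ edgeBoundary G S :=
  Finset.monotone_filter_right _ fun _ _ he => ⟨SimpleGraph.edgeSet_mono h he.1, he.2⟩

/-- A certificate keeps every edge of a cut that it crosses fewer than `k` times. -/
theorem IsConnCertificate.edgeBoundary_eq {V : Type*} [Fintype V] {k : ℕ} {G H : SimpleGraph V}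
    (h : IsConnCertificate k G H) {S : Finset V} (hS : (edgeBoundary H S).card < k) :
    edgeBoundary H S = edgeBoundary G S := by
  refine Finset.eq_of_subset_of_card_le (edgeBoundary_mono h.1 S) ?_
  have := h.2 S
  omega

theorem union_of_certificates_of_partition
    {V : Type*} [Fintype V] (G : SimpleGraph V) (c : ℕ) (hc : 1 ≤ c)
    (Gi : Fin c → SimpleGraph V)
    (hpart : (⨆ i, Gi i) = G)
    (hdisj : ∀ i j, i ≠ j → Disjoint (Gi i).edgeSet (Gi j).edgeSet)
    (k : ℕ) (hk : 1 ≤ k)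
    (Hi : Fin c → SimpleGraph V)
    (hHi : ∀ i, IsConnCertificate k (Gi i) (Hi i)) :
    IsConnCertificate k G (⨆ i, Hi i) := by
  subst hpart
  have hle : (⨆ i, Hi i) ≤ ⨆ i, Gi i := iSup_mono fun i => (hHi i).1
  refine ⟨hle, fun S => ?_⟩
  by_cases h : ∃ i, k ≤ (edgeBoundary (Hi i) S).card
  · obtain ⟨i, hi⟩ := h
    have hH := hi.trans (Finset.card_le_card (edgeBoundary_mono (le_iSup Hi i) S))
    have hG := hH.trans (Finset.card_le_card (edgeBoundary_mono hle S))
    rw [min_eq_left hH, min_eq_left hG]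
  · push Not at h
    have heq : edgeBoundary (⨆ i, Hi i) S = edgeBoundary (⨆ i, Gi i) S := by
      ext e
      simp only [mem_edgeBoundary_iSup, fun i => (hHi i).edgeBoundary_eq (h i)]
    rw [heq]
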